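/- The maps μ1(Z_{ij}) = Z_{j−i,j}, μ2(Z_{ij}) = Z_{N+1−j,N+1−i}, μ3(Z_{ij}) = Z_{i,N+1+i−j} extend to well-defined involutive algebra anti-automorphisms of the quantum torus T_N, and they satisfy μ1∘μ2 = μ2∘μ3 = μ3∘μ1 = ρ, where ρ is the order-3 automorphism ρ(Z_{ij}) = Z_{j−i,N+1−i}. -/

import Mathlib

/-- Entry `B_{v,w}` of the skew-symmetric incidence matrix of the triangular quiver
`Q_N`: edges go `(i,j)→(i,j+1)`, `(i,j)→(i+1,j)` and `(i+1,j+1)→(i,j)`. -/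
def Bfun (v w : ℕ × ℕ) : ℤ :=
  if (w = (v.1, v.2 + 1) ∨ w = (v.1 + 1, v.2) ∨ v = (w.1 + 1, w.2 + 1)) then 1
  else if (v = (w.1, w.2 + 1) ∨ v = (w.1 + 1, w.2) ∨ w = (v.1 + 1, v.2 + 1)) then -1
  else 0

/-- Vertices of the quiver `Q_N`: pairs `(i,j)` with `1 ≤ i < j ≤ N`. -/
def QIdx (N : ℕ) := {p : ℕ × ℕ // 1 ≤ p.1 ∧ p.1 < p.2 ∧ p.2 ≤ N}

/-- The defining relations of the quantum torus `T_N`. -/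
noncomputable def torusRel (N : ℕ) :
    FreeAlgebra (RatFunc ℚ) (QIdx N) → FreeAlgebra (RatFunc ℚ) (QIdx N) → Prop :=
  fun x y => ∃ v w : QIdx N,
    x = FreeAlgebra.ι (RatFunc ℚ) v * FreeAlgebra.ι (RatFunc ℚ) w ∧
    y = ((RatFunc.X : RatFunc ℚ) ^ (Bfun v.val w.val)) •
      (FreeAlgebra.ι (RatFunc ℚ) w * FreeAlgebra.ι (RatFunc ℚ) v)

/-- The quantum torus algebra `T_N` associated to the quiver `Q_N`. -/
noncomputable def QTorus (N : ℕ) := RingQuot (torusRel N)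

noncomputable instance (N : ℕ) : Ring (QTorus N) := by unfold QTorus; infer_instance
noncomputable instance (N : ℕ) : Algebra (RatFunc ℚ) (QTorus N) := by
  unfold QTorus; infer_instance

/-- The generator `Z_{ij}` of `T_N`. -/
noncomputable def Zgen (N : ℕ) (v : QIdx N) : QTorus N :=
  RingQuot.mkAlgHom (RatFunc ℚ) (torusRel N) (FreeAlgebra.ι (RatFunc ℚ) v)

namespace QTorus

variable {N : ℕ}

/-- The quotient map from the free algebra onto `T_N`. -/
noncomputable def mk (N : ℕ) : FreeAlgebra (RatFunc ℚ) (QIdx N) →ₐ[RatFunc ℚ] QTorus N :=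
  RingQuot.mkAlgHom (RatFunc ℚ) (torusRel N)

theorem mk_surjective (N : ℕ) : Function.Surjective (mk N) :=
  RingQuot.mkAlgHom_surjective (RatFunc ℚ) (torusRel N)

theorem mk_ι (v : QIdx N) : mk N (FreeAlgebra.ι (RatFunc ℚ) v) = Zgen N v := rfl

theorem Zgen_mul_Zgen (v w : QIdx N) :
    Zgen N v * Zgen N w =
      ((RatFunc.X : RatFunc ℚ) ^ Bfun v.val w.val) • (Zgen N w * Zgen N v) := by
  have h : mk N (FreeAlgebra.ι (RatFunc ℚ) v * FreeAlgebra.ι (RatFunc ℚ) w) =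
      mk N (((RatFunc.X : RatFunc ℚ) ^ Bfun v.val w.val) •
        (FreeAlgebra.ι (RatFunc ℚ) w * FreeAlgebra.ι (RatFunc ℚ) v)) :=
    RingQuot.mkAlgHom_rel (RatFunc ℚ) ⟨v, w, rfl, rfl⟩
  simpa only [map_mul, map_smul, mk_ι] using h

theorem induction {P : QTorus N → Prop}
    (algebraMap : ∀ r : RatFunc ℚ, P (algebraMap (RatFunc ℚ) (QTorus N) r))
    (gen : ∀ v, P (Zgen N v)) (mul : ∀ x y, P x → P y → P (x * y))
    (add : ∀ x y, P x → P y → P (x + y)) (x : QTorus N) : P x := by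
  obtain ⟨a, rfl⟩ := mk_surjective N x
  induction a using FreeAlgebra.induction with
  | grade0 r => simpa only [AlgHom.commutes] using algebraMap r
  | grade1 v => exact gen v
  | mul a b ha hb => simpa only [map_mul] using mul _ _ ha hb
  | add a b ha hb => simpa only [map_add] using add _ _ ha hb

/-- The universal property of `T_N`. -/
theorem exists_lift {A : Type*} [Ring A] [Algebra (RatFunc ℚ) A] (f : QIdx N → A)
    (hf : ∀ v w, f v * f w = ((RatFunc.X : RatFunc ℚ) ^ Bfun v.val w.val) • (f w * f v)) :
    ∃ φ : QTorus N →ₐ[RatFunc ℚ] A, ∀ v, φ (Zgen N v) = f v := by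
  have h : ∀ ⦃x y⦄, torusRel N x y →
      FreeAlgebra.lift (RatFunc ℚ) f x = FreeAlgebra.lift (RatFunc ℚ) f y := by
    rintro _ _ ⟨v, w, rfl, rfl⟩
    simpa only [map_mul, map_smul, FreeAlgebra.lift_ι_apply] using hf v w
  refine ⟨RingQuot.liftAlgHom (RatFunc ℚ) ⟨FreeAlgebra.lift (RatFunc ℚ) f, h⟩, fun v => ?_⟩
  exact (RingQuot.liftAlgHom_mkAlgHom_apply (RatFunc ℚ) _ h _).trans
    (FreeAlgebra.lift_ι_apply f v)

/-- An arrow-reversing map of the vertices of `Q_N` extends to an anti-endomorphism of `T_N`. -/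
theorem exists_antihom (σ : QIdx N → QIdx N)
    (hσ : ∀ v w, Bfun (σ w).val (σ v).val = Bfun v.val w.val) :
    ∃ μ : QTorus N →ₗ[RatFunc ℚ] QTorus N, μ 1 = 1 ∧ (∀ x y, μ (x * y) = μ y * μ x) ∧
      ∀ v, μ (Zgen N v) = Zgen N (σ v) := by
  obtain ⟨φ, hφ⟩ := exists_lift (fun v => MulOpposite.op (Zgen N (σ v))) fun v w => by
    rw [← MulOpposite.op_mul, ← MulOpposite.op_mul, ← MulOpposite.op_smul,
      Zgen_mul_Zgen (σ w) (σ v), hσ]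
  refine ⟨(MulOpposite.opLinearEquiv (RatFunc ℚ)).symm.toLinearMap ∘ₗ φ.toLinearMap,
    ?_, fun x y => ?_, fun v => ?_⟩
  · simp
  · simp
  · simp [hφ]

theorem map_algebraMap_of_map_one {μ : QTorus N →ₗ[RatFunc ℚ] QTorus N} (h : μ 1 = 1)
    (r : RatFunc ℚ) :
    μ (algebraMap (RatFunc ℚ) (QTorus N) r) = algebraMap (RatFunc ℚ) (QTorus N) r := by
  rw [Algebra.algebraMap_eq_smul_one, map_smul, h]

/-- An anti-endomorphism of `T_N` squaring to the identity on generators is an involution. -/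
theorem antihom_involutive {μ : QTorus N →ₗ[RatFunc ℚ] QTorus N} (h1 : μ 1 = 1)
    (hmul : ∀ x y, μ (x * y) = μ y * μ x) (hgen : ∀ v, μ (μ (Zgen N v)) = Zgen N v)
    (x : QTorus N) : μ (μ x) = x := by
  induction x using QTorus.induction with
  | algebraMap r => simp only [map_algebraMap_of_map_one h1]
  | gen v => exact hgen v
  | mul x y hx hy => rw [hmul, hmul, hx, hy]
  | add x y hx hy => rw [map_add, map_add, hx, hy]

/-- Composites of two anti-endomorphisms of `T_N` agree once they agree on generators. -/
theorem antihom_comp_ext {μ ν μ' ν' : QTorus N →ₗ[RatFunc ℚ] QTorus N}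
    (hμ1 : μ 1 = 1) (hν1 : ν 1 = 1) (hμ'1 : μ' 1 = 1) (hν'1 : ν' 1 = 1)
    (hμ : ∀ x y, μ (x * y) = μ y * μ x) (hν : ∀ x y, ν (x * y) = ν y * ν x)
    (hμ' : ∀ x y, μ' (x * y) = μ' y * μ' x) (hν' : ∀ x y, ν' (x * y) = ν' y * ν' x)
    (hgen : ∀ v, μ (ν (Zgen N v)) = μ' (ν' (Zgen N v))) (x : QTorus N) :
    μ (ν x) = μ' (ν' x) := by
  induction x using QTorus.induction with
  | algebraMap r =>
    simp only [map_algebraMap_of_map_one hμ1, map_algebraMap_of_map_one hν1,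
      map_algebraMap_of_map_one hμ'1, map_algebraMap_of_map_one hν'1]
  | gen v => exact hgen v
  | mul x y hx hy => rw [hν, hμ, hν', hμ', hx, hy]
  | add x y hx hy => simp only [map_add, hx, hy]

end QTorus

namespace QIdx

variable {N : ℕ}

/-- The reflection `(i,j) ↦ (j-i,j)`. -/
def reflectFst (v : QIdx N) : QIdx N :=
  ⟨(v.val.2 - v.val.1, v.val.2), by have := v.property; dsimp only; omega⟩

/-- The reflection `(i,j) ↦ (N+1-j,N+1-i)`. -/
def reflectDiag (v : QIdx N) : QIdx N :=
  ⟨(N + 1 - v.val.2, N + 1 - v.val.1), by have := v.property; dsimp only; omega⟩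

/-- The reflection `(i,j) ↦ (i,N+1+i-j)`. -/
def reflectSnd (v : QIdx N) : QIdx N :=
  ⟨(v.val.1, N + 1 + v.val.1 - v.val.2), by have := v.property; dsimp only; omega⟩

theorem Bfun_reflectFst (v w : QIdx N) :
    Bfun w.reflectFst.val v.reflectFst.val = Bfun v.val w.val := by
  obtain ⟨⟨i, j⟩, hv⟩ := v
  obtain ⟨⟨k, l⟩, hw⟩ := w
  simp only [Bfun, reflectFst, Prod.mk.injEq] at *
  split_ifs <;> omega

theorem Bfun_reflectDiag (v w : QIdx N) :
    Bfun w.reflectDiag.val v.reflectDiag.val = Bfun v.val w.val := by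
  obtain ⟨⟨i, j⟩, hv⟩ := v
  obtain ⟨⟨k, l⟩, hw⟩ := w
  simp only [Bfun, reflectDiag, Prod.mk.injEq] at *
  split_ifs <;> omega

theorem Bfun_reflectSnd (v w : QIdx N) :
    Bfun w.reflectSnd.val v.reflectSnd.val = Bfun v.val w.val := by
  obtain ⟨⟨i, j⟩, hv⟩ := v
  obtain ⟨⟨k, l⟩, hw⟩ := w
  simp only [Bfun, reflectSnd, Prod.mk.injEq] at *
  split_ifs <;> omega

theorem reflectFst_reflectFst (v : QIdx N) : v.reflectFst.reflectFst = v := by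
  obtain ⟨⟨i, j⟩, hv⟩ := v
  refine Subtype.ext (Prod.ext ?_ ?_) <;> simp only [reflectFst] at * <;> omega

theorem reflectDiag_reflectDiag (v : QIdx N) : v.reflectDiag.reflectDiag = v := by
  obtain ⟨⟨i, j⟩, hv⟩ := v
  refine Subtype.ext (Prod.ext ?_ ?_) <;> simp only [reflectDiag] at * <;> omega

theorem reflectSnd_reflectSnd (v : QIdx N) : v.reflectSnd.reflectSnd = v := by
  obtain ⟨⟨i, j⟩, hv⟩ := v
  refine Subtype.ext (Prod.ext ?_ ?_) <;> simp only [reflectSnd] at * <;> omega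

theorem reflectFst_reflectDiag (v : QIdx N) :
    v.reflectDiag.reflectFst =
      ⟨(v.val.2 - v.val.1, N + 1 - v.val.1), by have := v.property; dsimp only; omega⟩ := by
  obtain ⟨⟨i, j⟩, hv⟩ := v
  refine Subtype.ext (Prod.ext ?_ ?_) <;> simp only [reflectFst, reflectDiag] at * <;> omega

theorem reflectDiag_reflectSnd (v : QIdx N) :
    v.reflectSnd.reflectDiag = v.reflectDiag.reflectFst := by
  obtain ⟨⟨i, j⟩, hv⟩ := v
  refine Subtype.ext (Prod.ext ?_ ?_) <;> simp only [reflectFst, reflectDiag, reflectSnd] at * <;> omega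

theorem reflectSnd_reflectFst (v : QIdx N) :
    v.reflectFst.reflectSnd = v.reflectSnd.reflectDiag := by
  obtain ⟨⟨i, j⟩, hv⟩ := v
  refine Subtype.ext (Prod.ext ?_ ?_) <;> simp only [reflectFst, reflectDiag, reflectSnd] at * <;> omega

end QIdx

/-- The assignments `μ₁(Z_{ij}) = Z_{j-i,j}`, `μ₂(Z_{ij}) = Z_{N+1-j,N+1-i}`,
`μ₃(Z_{ij}) = Z_{i,N+1+i-j}` extend to well-defined involutive (linear)
anti-automorphisms of `T_N`, and `μ₁∘μ₂ = μ₂∘μ₃ = μ₃∘μ₁ = ρ`, where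
`ρ(Z_{ij}) = Z_{j-i,N+1-i}`. -/
theorem exists_reflection_antiautomorphisms (N : ℕ) (hN : 2 ≤ N) :
    ∃ μ₁ μ₂ μ₃ : QTorus N →ₗ[RatFunc ℚ] QTorus N,
      (μ₁ 1 = 1 ∧ μ₂ 1 = 1 ∧ μ₃ 1 = 1) ∧
      (∀ x y : QTorus N, μ₁ (x * y) = μ₁ y * μ₁ x) ∧
      (∀ x y : QTorus N, μ₂ (x * y) = μ₂ y * μ₂ x) ∧
      (∀ x y : QTorus N, μ₃ (x * y) = μ₃ y * μ₃ x) ∧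
      (∀ x : QTorus N, μ₁ (μ₁ x) = x) ∧
      (∀ x : QTorus N, μ₂ (μ₂ x) = x) ∧
      (∀ x : QTorus N, μ₃ (μ₃ x) = x) ∧
      (∀ (i j : ℕ) (h : 1 ≤ i ∧ i < j ∧ j ≤ N),
        μ₁ (Zgen N ⟨(i, j), h⟩) = Zgen N ⟨(j - i, j), by omega⟩ ∧
        μ₂ (Zgen N ⟨(i, j), h⟩) = Zgen N ⟨(N + 1 - j, N + 1 - i), by omega⟩ ∧
        μ₃ (Zgen N ⟨(i, j), h⟩) = Zgen N ⟨(i, N + 1 + i - j), by omega⟩) ∧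
      (∀ x : QTorus N, μ₁ (μ₂ x) = μ₂ (μ₃ x) ∧ μ₂ (μ₃ x) = μ₃ (μ₁ x)) ∧
      (∀ (i j : ℕ) (h : 1 ≤ i ∧ i < j ∧ j ≤ N),
        μ₁ (μ₂ (Zgen N ⟨(i, j), h⟩)) = Zgen N ⟨(j - i, N + 1 - i), by omega⟩) := by
  obtain ⟨μ₁, h₁, m₁, g₁⟩ := QTorus.exists_antihom _ (QIdx.Bfun_reflectFst (N := N))
  obtain ⟨μ₂, h₂, m₂, g₂⟩ := QTorus.exists_antihom _ (QIdx.Bfun_reflectDiag (N := N))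
  obtain ⟨μ₃, h₃, m₃, g₃⟩ := QTorus.exists_antihom _ (QIdx.Bfun_reflectSnd (N := N))
  refine ⟨μ₁, μ₂, μ₃, ⟨h₁, h₂, h₃⟩, m₁, m₂, m₃,
    QTorus.antihom_involutive h₁ m₁ fun v => ?_, QTorus.antihom_involutive h₂ m₂ fun v => ?_,
    QTorus.antihom_involutive h₃ m₃ fun v => ?_, fun i j h => ⟨g₁ _, g₂ _, g₃ _⟩,
    fun x => ⟨QTorus.antihom_comp_ext h₁ h₂ h₂ h₃ m₁ m₂ m₂ m₃ (fun v => ?_) x,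
      QTorus.antihom_comp_ext h₂ h₃ h₃ h₁ m₂ m₃ m₃ m₁ (fun v => ?_) x⟩, fun i j h => ?_⟩
  · rw [g₁, g₁, QIdx.reflectFst_reflectFst]
  · rw [g₂, g₂, QIdx.reflectDiag_reflectDiag]
  · rw [g₃, g₃, QIdx.reflectSnd_reflectSnd]
  · rw [g₂, g₁, g₃, g₂, QIdx.reflectDiag_reflectSnd]
  · rw [g₃, g₂, g₁, g₃, QIdx.reflectSnd_reflectFst]
  · exact (congrArg μ₁ (g₂ _)).trans <| (g₁ _).trans <|
      congrArg (Zgen N) (QIdx.reflectFst_reflectDiag _)
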